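/- arXiv:math/0311012 — 2 statements merged into one kernel-verified Lean document; each statement's English description precedes it below -/
import Mathlib

section
/- Let W ≤ GL(V) be a finite complex reflection group of rank n with degrees d_1, ..., d_n and exponents m_i = d_i − 1. Then the number of pseudo-reflections in W equals m_1 + m_2 + ⋯ + m_n. -/
open MvPolynomial

variable {n : ℕ}

/-- A (pseudo-)reflection: a non-trivial element of `GL(V)` of finite order
which fixes a hyperplane (a subspace of codimension one) pointwise. -/
def IsPseudoReflection (g : (Fin n → ℂ) ≃ₗ[ℂ] (Fin n → ℂ)) : Prop :=
  g ≠ 1 ∧ IsOfFinOrder g ∧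
    ∃ H : Submodule ℂ (Fin n → ℂ),
      Module.finrank ℂ H + 1 = n ∧ ∀ v ∈ H, g v = v

/-- The matrix of a linear automorphism of `Fin n → ℂ` in the standard basis. -/
noncomputable def glMatrix (g : (Fin n → ℂ) ≃ₗ[ℂ] (Fin n → ℂ)) :
    Matrix (Fin n) (Fin n) ℂ :=
  LinearMap.toMatrix (Pi.basisFun ℂ (Fin n)) (Pi.basisFun ℂ (Fin n)) g.toLinearMap

/-- The induced action of a linear automorphism on the algebra
`ℂ[V] = ℂ[X_1, ..., X_n]` of polynomial functions on `V`. -/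
noncomputable def polyAct (g : (Fin n → ℂ) ≃ₗ[ℂ] (Fin n → ℂ)) :
    MvPolynomial (Fin n) ℂ →ₐ[ℂ] MvPolynomial (Fin n) ℂ :=
  MvPolynomial.aeval fun i => ∑ j, MvPolynomial.C (glMatrix g i j) * MvPolynomial.X j

/-- The subalgebra `ℂ[V]^W` of `W`-invariant polynomials. -/
noncomputable def invariantsAlg (W : Subgroup ((Fin n → ℂ) ≃ₗ[ℂ] (Fin n → ℂ))) :
    Subalgebra ℂ (MvPolynomial (Fin n) ℂ) where
  carrier := {p | ∀ g ∈ W, polyAct g p = p}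
  mul_mem' := by
    intro a b ha hb g hg
    simp only [map_mul, ha g hg, hb g hg]
  add_mem' := by
    intro a b ha hb g hg
    simp only [map_add, ha g hg, hb g hg]
  algebraMap_mem' := by
    intro r g hg
    simp [polyAct]

/-- `W` is a (complex) reflection group: it is generated by the
pseudo-reflections it contains. -/
def IsReflectionGroup (W : Subgroup ((Fin n → ℂ) ≃ₗ[ℂ] (Fin n → ℂ))) : Prop :=
  Subgroup.closure {g | g ∈ W ∧ IsPseudoReflection g} = W

/-- `f` is a system of basic invariants of `W` with degrees `d`: the `f i` are
`W`-invariant, homogeneous of degree `d i`, algebraically independent, and they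
generate the algebra of invariants `ℂ[V]^W`. -/
def IsBasicInvariants (W : Subgroup ((Fin n → ℂ) ≃ₗ[ℂ] (Fin n → ℂ)))
    (f : Fin n → MvPolynomial (Fin n) ℂ) (d : Fin n → ℕ) : Prop :=
  (∀ i, f i ∈ invariantsAlg W) ∧
  (∀ i, (f i).IsHomogeneous (d i)) ∧
  Function.Injective (MvPolynomial.aeval (R := ℂ) f) ∧
  (MvPolynomial.aeval (R := ℂ) f).range = invariantsAlg W

section GeneratingFunctions

/-- The exponent vectors of weight `k`, where the `i`-th variable has weight `w i`. -/
noncomputable def exponentsOfWeight (w : Fin n → ℕ) (hw : ∀ i, w i ≠ 0) (k : ℕ) :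
    Finset (Fin n →₀ ℕ) :=
  (Finsupp.finite_of_nat_weight_eq w hw k).toFinset

lemma mem_exponentsOfWeight {w : Fin n → ℕ} {hw : ∀ i, w i ≠ 0} {k : ℕ} {m : Fin n →₀ ℕ} :
    m ∈ exponentsOfWeight w hw k ↔ Finsupp.weight w m = k := by
  simp [exponentsOfWeight]

/-- The power series `1 + a X ^ d + a ^ 2 X ^ (2 * d) + ⋯`. -/
noncomputable def geometricSeries (a : ℂ) (d : ℕ) : PowerSeries ℂ :=
  PowerSeries.mk fun l => if d ∣ l then a ^ (l / d) else 0

lemma geometricSeries_mul_one_sub (a : ℂ) {d : ℕ} (hd : d ≠ 0) :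
    geometricSeries a d * ((1 - Polynomial.C a * Polynomial.X ^ d : Polynomial ℂ) : PowerSeries ℂ)
      = 1 := by
  ext l
  simp only [Polynomial.coe_sub, Polynomial.coe_one, Polynomial.coe_mul, Polynomial.coe_C,
    Polynomial.coe_pow, Polynomial.coe_X, mul_sub, mul_one, map_sub]
  rw [mul_left_comm, PowerSeries.coeff_C_mul, PowerSeries.coeff_mul_X_pow', PowerSeries.coeff_one]
  simp only [geometricSeries, PowerSeries.coeff_mk]
  rcases lt_or_ge l d with h | h
  · rw [if_neg h.not_ge, mul_zero, sub_zero]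
    rcases Nat.eq_zero_or_pos l with rfl | hl
    · simp
    · rw [if_neg (fun hdvd => h.not_ge (Nat.le_of_dvd hl hdvd)), if_neg hl.ne']
  · rw [if_pos h, if_neg (by lia : l ≠ 0)]
    obtain ⟨l, rfl⟩ := Nat.exists_eq_add_of_le h
    simp only [Nat.add_sub_cancel_left, Nat.dvd_add_self_left]
    split_ifs
    · rw [Nat.add_div_left _ (Nat.pos_of_ne_zero hd), pow_succ]; ring
    · simp

lemma prod_geometricSeries (w : Fin n → ℕ) (hw : ∀ i, w i ≠ 0) (x : Fin n → ℂ) :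
    ∏ i, geometricSeries (x i) (w i) =
      PowerSeries.mk fun k => ∑ m ∈ exponentsOfWeight w hw k, ∏ i, x i ^ m i := by
  ext k
  rw [PowerSeries.coeff_prod, PowerSeries.coeff_mk]
  simp only [geometricSeries, PowerSeries.coeff_mk]
  trans ∑ l ∈ Finset.finsuppAntidiag Finset.univ k with ∀ i ∈ Finset.univ, w i ∣ l i,
      ∏ i, x i ^ (l i / w i)
  · rw [Finset.sum_filter]
    exact Finset.sum_congr rfl fun l _ => Finset.prod_ite_zero.trans (by congr)
  symm
  refine Finset.sum_bij' (fun m _ => Finsupp.equivFunOnFinite.symm fun i => m i * w i)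
    (fun l _ => Finsupp.equivFunOnFinite.symm fun i => l i / w i) ?_ ?_ ?_ ?_ ?_
  · intro m hm
    rw [mem_exponentsOfWeight, Finsupp.weight_apply, Finsupp.sum_fintype _ _ (by simp)] at hm
    simpa [Finset.mem_finsuppAntidiag] using hm
  · intro l hl
    simp only [Finset.mem_filter, Finset.mem_finsuppAntidiag] at hl
    rw [mem_exponentsOfWeight, Finsupp.weight_apply, Finsupp.sum_fintype _ _ (by simp), ← hl.1.1]
    exact Finset.sum_congr rfl fun i hi => by simpa using Nat.div_mul_cancel (hl.2 i hi)
  · intro m _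
    ext i
    simp [Nat.mul_div_cancel _ (Nat.pos_of_ne_zero (hw i))]
  · intro l hl
    simp only [Finset.mem_filter, Finset.mem_finsuppAntidiag] at hl
    ext i
    simpa using Nat.div_mul_cancel (hl.2 i (Finset.mem_univ i))
  · intro m _
    simp [Nat.mul_div_cancel _ (Nat.pos_of_ne_zero (hw _))]

/-- A linear relation between the power series inverses of polynomials holds pointwise. -/
lemma sum_mul_eval_inv_eq_zero {ι : Type*} [Fintype ι] (c : ι → ℂ) (F : ι → PowerSeries ℂ)
    (P : ι → Polynomial ℂ) (hFP : ∀ s, F s * (P s : PowerSeries ℂ) = 1)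
    (hF : ∑ s, PowerSeries.C (c s) * F s = 0) (t : ℂ) (ht : ∀ s, (P s).eval t ≠ 0) :
    ∑ s, c s * ((P s).eval t)⁻¹ = 0 := by
  classical
  have hQ : ∑ s, Polynomial.C (c s) * ∏ r ∈ Finset.univ.erase s, P r = 0 := by
    apply Polynomial.coe_injective (R := ℂ)
    rw [Polynomial.coe_zero]
    calc ((∑ s, Polynomial.C (c s) * ∏ r ∈ Finset.univ.erase s, P r : Polynomial ℂ) :
          PowerSeries ℂ)
        = ∑ s, PowerSeries.C (c s) * ∏ r ∈ Finset.univ.erase s, (P r : PowerSeries ℂ) := by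
          simp only [← Polynomial.coeToPowerSeries.ringHom_apply, map_sum, map_mul, map_prod]
          simp [Polynomial.coeToPowerSeries.ringHom_apply]
      _ = ∑ s, (PowerSeries.C (c s) * F s) * ∏ r, (P r : PowerSeries ℂ) := by
          refine Finset.sum_congr rfl fun s _ => ?_
          rw [← Finset.mul_prod_erase _ _ (Finset.mem_univ s)]
          linear_combination (-PowerSeries.C (c s) *
            ∏ r ∈ Finset.univ.erase s, (P r : PowerSeries ℂ)) * hFP s
      _ = 0 := by rw [← Finset.sum_mul, hF, zero_mul]
  have hQt := congrArg (Polynomial.eval t) hQ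
  simp only [Polynomial.eval_finsetSum, Polynomial.eval_mul, Polynomial.eval_C,
    Polynomial.eval_prod, Polynomial.eval_zero] at hQt
  have hprod : ∏ r, (P r).eval t ≠ 0 := Finset.prod_ne_zero_iff.mpr fun r _ => ht r
  refine (mul_eq_zero.mp ?_).resolve_right hprod
  rw [← hQt, Finset.sum_mul]
  refine Finset.sum_congr rfl fun s _ => ?_
  rw [← Finset.mul_prod_erase _ _ (Finset.mem_univ s), mul_assoc, inv_mul_cancel_left₀ (ht s)]

end GeneratingFunctions

section Action

lemma polyAct_X (g : (Fin n → ℂ) ≃ₗ[ℂ] (Fin n → ℂ)) (i : Fin n) :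
    polyAct g (X i) = ∑ j, C (glMatrix g i j) * X j := by
  simp [polyAct]

lemma glMatrix_mul (g h : (Fin n → ℂ) ≃ₗ[ℂ] (Fin n → ℂ)) :
    glMatrix (g * h) = glMatrix g * glMatrix h :=
  LinearMap.toMatrix_comp (Pi.basisFun ℂ (Fin n)) (Pi.basisFun ℂ (Fin n))
    (Pi.basisFun ℂ (Fin n)) g.toLinearMap h.toLinearMap

lemma polyAct_mul (g h : (Fin n → ℂ) ≃ₗ[ℂ] (Fin n → ℂ)) :
    polyAct (g * h) = (polyAct h).comp (polyAct g) := by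
  ext1 i
  simp only [AlgHom.comp_apply, polyAct_X, map_sum, map_mul, glMatrix_mul, Matrix.mul_apply,
    MvPolynomial.algHom_C, MvPolynomial.algebraMap_eq, Finset.sum_mul, Finset.mul_sum]
  rw [Finset.sum_comm]
  simp only [mul_assoc]

lemma isHomogeneous_polyAct (g : (Fin n → ℂ) ≃ₗ[ℂ] (Fin n → ℂ)) {k : ℕ}
    {p : MvPolynomial (Fin n) ℂ} (hp : p.IsHomogeneous k) : (polyAct g p).IsHomogeneous k := by
  rw [← one_mul k]
  exact hp.aeval _ fun i => IsHomogeneous.sum _ _ _ fun j _ => isHomogeneous_C_mul_X _ _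

/-- The action of `g` on the homogeneous polynomials of degree `k`. -/
noncomputable def homogeneousAct (g : (Fin n → ℂ) ≃ₗ[ℂ] (Fin n → ℂ)) (k : ℕ) :
    Module.End ℂ (homogeneousSubmodule (Fin n) ℂ k) :=
  (polyAct g).toLinearMap.restrict fun _ hp => isHomogeneous_polyAct g hp

lemma coe_homogeneousAct (g : (Fin n → ℂ) ≃ₗ[ℂ] (Fin n → ℂ)) {k : ℕ}
    (p : homogeneousSubmodule (Fin n) ℂ k) :
    (homogeneousAct g k p : MvPolynomial (Fin n) ℂ) = polyAct g p := rfl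

lemma homogeneousAct_mul (g h : (Fin n → ℂ) ≃ₗ[ℂ] (Fin n → ℂ)) (k : ℕ) :
    homogeneousAct (g * h) k = homogeneousAct h k * homogeneousAct g k := by
  ext1 p
  apply Subtype.ext
  simp [coe_homogeneousAct, polyAct_mul]

instance finite_homogeneousSubmodule (k : ℕ) :
    Module.Finite ℂ (homogeneousSubmodule (Fin n) ℂ k) :=
  Module.Finite.iff_fg.mpr (homogeneousSubmodule_fg (Fin n) ℂ k)

/-- The monomials of weight `k` form a basis of the space of weighted homogeneous polynomials. -/
noncomputable def weightedHomogeneousBasis (w : Fin n → ℕ) (hw : ∀ i, w i ≠ 0) (k : ℕ) :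
    Module.Basis (exponentsOfWeight w hw k) ℂ (weightedHomogeneousSubmodule ℂ w k) :=
  Module.Basis.mk
    (v := fun m => ⟨monomial m.1 1,
      isWeightedHomogeneous_monomial w m.1 1 (mem_exponentsOfWeight.mp m.2)⟩)
    (by
      apply LinearIndependent.of_comp (weightedHomogeneousSubmodule ℂ w k).subtype
      have h := (basisMonomials (Fin n) ℂ).linearIndependent
      rw [coe_basisMonomials] at h
      exact h.comp _ Subtype.val_injective)
    (by
      rintro ⟨p, hp⟩ -
      induction hp using IsWeightedHomogeneous.induction_on with
      | zero => exact Submodule.zero_mem _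
      | add p q hp hq ihp ihq => exact Submodule.add_mem _ ihp ihq
      | monomial d r hr =>
        have := Submodule.smul_mem _ r (Submodule.subset_span (R := ℂ)
          (Set.mem_range_self (f := fun m : exponentsOfWeight w hw k =>
            (⟨monomial m.1 1, isWeightedHomogeneous_monomial w m.1 1
              (mem_exponentsOfWeight.mp m.2)⟩ : weightedHomogeneousSubmodule ℂ w k))
            ⟨d, mem_exponentsOfWeight.mpr hr⟩))
        convert this using 1
        apply Subtype.ext
        simp [smul_monomial])

lemma coe_weightedHomogeneousBasis (w : Fin n → ℕ) (hw : ∀ i, w i ≠ 0) (k : ℕ)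
    (m : exponentsOfWeight w hw k) :
    (weightedHomogeneousBasis w hw k m : MvPolynomial (Fin n) ℂ) = monomial m.1 1 := by
  simp [weightedHomogeneousBasis]

/-- `x` lists the eigenvalues of `g` with respect to some basis of eigenvectors. -/
def HasEigenvalueFamily (g : (Fin n → ℂ) ≃ₗ[ℂ] (Fin n → ℂ)) (x : Fin n → ℂ) : Prop :=
  ∃ b : Module.Basis (Fin n) ℂ (Fin n → ℂ), ∀ i, g (b i) = x i • b i

lemma polyAct_monomial_of_glMatrix_eq_diagonal {g : (Fin n → ℂ) ≃ₗ[ℂ] (Fin n → ℂ)}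
    {x : Fin n → ℂ} (hg : glMatrix g = Matrix.diagonal x) (m : Fin n →₀ ℕ) :
    polyAct g (monomial m 1) = (∏ i, x i ^ m i) • monomial m 1 := by
  have hX (i : Fin n) : polyAct g (X i) = C (x i) * X i := by
    rw [polyAct_X, hg, Finset.sum_eq_single i]
    · simp
    · intro j _ hj
      simp [Matrix.diagonal_apply_ne _ hj.symm]
    · simp
  rw [monomial_eq, C_1, one_mul, Finsupp.prod_fintype _ _ (by simp), map_prod, smul_eq_C_mul,
    map_prod, ← Finset.prod_mul_distrib]
  exact Finset.prod_congr rfl fun i _ => by rw [map_pow, hX, mul_pow, C_pow]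

lemma trace_homogeneousAct_of_glMatrix_eq_diagonal {g : (Fin n → ℂ) ≃ₗ[ℂ] (Fin n → ℂ)}
    {x : Fin n → ℂ} (hg : glMatrix g = Matrix.diagonal x) (k : ℕ) :
    LinearMap.trace ℂ _ (homogeneousAct g k) =
      ∑ m ∈ exponentsOfWeight (1 : Fin n → ℕ) (fun _ => one_ne_zero) k, ∏ i, x i ^ m i := by
  let b : Module.Basis _ ℂ (homogeneousSubmodule (Fin n) ℂ k) :=
    weightedHomogeneousBasis (1 : Fin n → ℕ) (fun _ => one_ne_zero) k
  have hb m : homogeneousAct g k (b m) = (∏ i, x i ^ m.1 i) • b m := by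
    apply Subtype.ext
    rw [coe_homogeneousAct, Submodule.coe_smul]
    exact (congrArg (polyAct g) (coe_weightedHomogeneousBasis _ _ k m)).trans
      ((polyAct_monomial_of_glMatrix_eq_diagonal hg m.1).trans
        (congrArg _ (coe_weightedHomogeneousBasis _ _ k m).symm))
  rw [LinearMap.trace_eq_matrix_trace ℂ b, Matrix.trace,
    ← Finset.sum_coe_sort _ fun m : Fin n →₀ ℕ => ∏ i, x i ^ m i]
  refine Finset.sum_congr rfl fun m _ => ?_
  simp [Matrix.diag_apply, LinearMap.toMatrix_apply, hb]

lemma HasEigenvalueFamily.trace_homogeneousAct {g : (Fin n → ℂ) ≃ₗ[ℂ] (Fin n → ℂ)}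
    {x : Fin n → ℂ} (hg : HasEigenvalueFamily g x) (k : ℕ) :
    LinearMap.trace ℂ _ (homogeneousAct g k) =
      ∑ m ∈ exponentsOfWeight (1 : Fin n → ℕ) (fun _ => one_ne_zero) k, ∏ i, x i ^ m i := by
  obtain ⟨b, hb⟩ := hg
  let p : (Fin n → ℂ) ≃ₗ[ℂ] (Fin n → ℂ) := (Pi.basisFun ℂ (Fin n)).equiv b (Equiv.refl _)
  have hp (i : Fin n) : p (Pi.basisFun ℂ (Fin n) i) = b i :=
    (Module.Basis.equiv_apply _ _ _ _).trans (by simp)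
  have hdiag : glMatrix (p⁻¹ * (g * p)) = Matrix.diagonal x := by
    ext i j
    have : (p⁻¹ * (g * p)) (Pi.basisFun ℂ (Fin n) j) = x j • Pi.basisFun ℂ (Fin n) j := by
      change p.symm (g (p (Pi.basisFun ℂ (Fin n) j))) = _
      rw [LinearEquiv.symm_apply_eq, hp, hb, map_smul, hp]
    rw [glMatrix, LinearMap.toMatrix_apply, LinearEquiv.coe_coe, this]
    by_cases hij : i = j
    · subst hij; simp
    · simp [hij]
  rw [← trace_homogeneousAct_of_glMatrix_eq_diagonal hdiag, homogeneousAct_mul,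
    LinearMap.trace_mul_comm, ← homogeneousAct_mul, mul_inv_cancel_right]

end Action

section Eigenvalues

variable {g : (Fin n → ℂ) ≃ₗ[ℂ] (Fin n → ℂ)} {x : Fin n → ℂ}

lemma exists_hasEigenvalueFamily (hg : IsOfFinOrder g) : ∃ x, HasEigenvalueFamily g x := by
  classical
  obtain ⟨N, hN, hgN⟩ := isOfFinOrder_iff_pow_eq_one.mp hg
  let φ : Module.End ℂ (Fin n → ℂ) := g.toLinearMap
  have hφN : φ ^ N = 1 := by
    have h := congrArg (LinearEquiv.automorphismGroup.toLinearMapMonoidHom) hgN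
    rw [map_pow, map_one] at h
    exact h
  have hφ : φ.IsSemisimple := by
    refine Module.End.isSemisimple_of_squarefree_aeval_eq_zero (p := Polynomial.X ^ N - 1) ?_ ?_
    · exact (Polynomial.separable_X_pow_sub_C (1 : ℂ) (by exact_mod_cast hN.ne')
        one_ne_zero).squarefree
    · simp [hφN]
  let e := DirectSum.isInternal_submodule_of_iSupIndep_of_iSup_eq_top
    φ.eigenspaces_iSupIndep hφ.iSup_eigenspace_eq_top
  let v := e.collectedBasis fun μ => Module.finBasis ℂ (φ.eigenspace μ)
  let σ := v.indexEquiv (Pi.basisFun ℂ (Fin n))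
  refine ⟨fun i => (σ.symm i).1, v.reindex σ, fun i => ?_⟩
  rw [Module.Basis.reindex_apply]
  exact Module.End.mem_eigenspace_iff.mp (e.collectedBasis_mem _ (σ.symm i))

namespace HasEigenvalueFamily

lemma ne_zero (h : HasEigenvalueFamily g x) (i : Fin n) : x i ≠ 0 := by
  obtain ⟨b, hb⟩ := h
  intro hi
  have := hb i
  rw [hi, zero_smul, LinearEquiv.map_eq_zero_iff] at this
  exact b.ne_zero i this

lemma inv (h : HasEigenvalueFamily g x) : HasEigenvalueFamily g⁻¹ x⁻¹ := by
  have hx := h.ne_zero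
  obtain ⟨b, hb⟩ := h
  refine ⟨b, fun i => ?_⟩
  change g.symm (b i) = _
  rw [LinearEquiv.symm_apply_eq, map_smul, hb, smul_smul, Pi.inv_apply, inv_mul_cancel₀ (hx i),
    one_smul]

lemma forall_eq_one_iff (h : HasEigenvalueFamily g x) : (∀ i, x i = 1) ↔ g = 1 := by
  obtain ⟨b, hb⟩ := h
  constructor
  · intro hx
    refine LinearEquiv.toLinearMap_injective (b.ext fun i => ?_)
    simp [hb, hx]
  · rintro rfl i
    have := hb i
    rw [LinearEquiv.coe_one, id, eq_comm] at this
    exact smul_left_injective ℂ (b.ne_zero i) (this.trans (one_smul ℂ _).symm)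

lemma isPseudoReflection_iff (h : HasEigenvalueFamily g x) (hg : IsOfFinOrder g) :
    IsPseudoReflection g ↔ ∃! i, x i ≠ 1 := by
  have h1 := h.forall_eq_one_iff
  obtain ⟨b, hb⟩ := h
  have hker (i : Fin n) : Module.finrank ℂ (LinearMap.ker (b.coord i)) + 1 = n := by
    have hi : b.coord i ≠ 0 := fun h0 => by
      have := LinearMap.congr_fun h0 (b i)
      simp at this
    simpa using Module.Dual.finrank_ker_add_one_of_ne_zero hi
  have hrepr (v : Fin n → ℂ) (i : Fin n) : b.repr (g v) i = x i * b.repr v i := by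
    obtain ⟨c, rfl⟩ : ∃ c : Fin n → ℂ, v = ∑ j, c j • b j := ⟨b.repr v, (b.sum_repr v).symm⟩
    simp [hb, Finsupp.single_apply, mul_comm]
  constructor
  · rintro ⟨hne, -, H, hH, hfix⟩
    have hHker (i : Fin n) (hi : x i ≠ 1) : H = LinearMap.ker (b.coord i) := by
      refine Submodule.eq_of_le_of_finrank_eq (fun v hv => ?_)
        (Nat.add_right_cancel (hH.trans (hker i).symm))
      have := hrepr v i
      rw [hfix v hv] at this
      exact (mul_eq_zero.mp (by linear_combination this : (1 - x i) * b.repr v i = 0)).resolve_left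
        (sub_ne_zero.mpr hi.symm)
    obtain ⟨i, hi⟩ := not_forall.mp (mt h1.mp hne)
    refine ⟨i, hi, fun j hj => ?_⟩
    by_contra hij
    have hmem : b j ∈ LinearMap.ker (b.coord i) := by
      simp [Finsupp.single_eq_of_ne' hij]
    rw [← hHker i hi, hHker j hj] at hmem
    simp at hmem
  · rintro ⟨i, hi, huniq⟩
    refine ⟨fun h => hi (h1.mpr h i), hg, _, hker i, fun v hv => ?_⟩
    refine b.ext_elem fun j => ?_
    rw [hrepr]
    by_cases hj : x j = 1
    · rw [hj, one_mul]
    · obtain rfl := huniq j hj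
      have : b.repr v j = 0 := hv
      rw [this, mul_zero]

end HasEigenvalueFamily

end Eigenvalues

section Molien

variable (W : Subgroup ((Fin n → ℂ) ≃ₗ[ℂ] (Fin n → ℂ)))

/-- The `W`-invariant homogeneous polynomials of degree `k`. -/
noncomputable def homogeneousInvariants (k : ℕ) :
    Submodule ℂ (homogeneousSubmodule (Fin n) ℂ k) :=
  (Subalgebra.toSubmodule (invariantsAlg W)).comap (Submodule.subtype _)

variable {W}

lemma mem_homogeneousInvariants {k : ℕ} {p : homogeneousSubmodule (Fin n) ℂ k} :
    p ∈ homogeneousInvariants W k ↔ ∀ g ∈ W, homogeneousAct g k p = p :=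
  ⟨fun h g hg => Subtype.ext (h g hg), fun h g hg => congrArg Subtype.val (h g hg)⟩

lemma isProj_average [Fintype W] (k : ℕ) :
    LinearMap.IsProj (homogeneousInvariants W k)
      ((Fintype.card W : ℂ)⁻¹ • ∑ g : W, homogeneousAct g.1 k) := by
  constructor
  · intro p
    rw [mem_homogeneousInvariants]
    intro h hh
    simp only [LinearMap.smul_apply, LinearMap.sum_apply, map_smul, map_sum]
    refine congrArg ((Fintype.card W : ℂ)⁻¹ • ·) ?_
    rw [← Equiv.sum_comp (Equiv.mulRight (⟨h, hh⟩ : W)) fun g : W => homogeneousAct g.1 k p]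
    refine Finset.sum_congr rfl fun g _ => ?_
    simp [homogeneousAct_mul]
  · intro p hp
    rw [mem_homogeneousInvariants] at hp
    simp only [LinearMap.smul_apply, LinearMap.sum_apply]
    rw [Finset.sum_congr rfl fun g _ => hp g.1 g.2, Finset.sum_const, Finset.card_univ,
      ← Nat.cast_smul_eq_nsmul ℂ, smul_smul, inv_mul_cancel₀, one_smul]
    exact_mod_cast Fintype.card_ne_zero

lemma card_mul_finrank_homogeneousInvariants [Fintype W] (k : ℕ) :
    (Fintype.card W : ℂ) * Module.finrank ℂ (homogeneousInvariants W k) =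
      ∑ g : W, LinearMap.trace ℂ _ (homogeneousAct g.1 k) := by
  have : Module.Free ℂ (homogeneousInvariants W k) :=
    @Module.Free.of_divisionRing ℂ _ _ (Submodule.addCommGroup _) (Submodule.module _)
  have : Module.Free ℂ (LinearMap.ker
      ((Fintype.card W : ℂ)⁻¹ • ∑ g : W, homogeneousAct g.1 k)) :=
    @Module.Free.of_divisionRing ℂ _ _ (Submodule.addCommGroup _) (Submodule.module _)
  rw [← (isProj_average (W := W) k).trace, map_smul, map_sum, smul_eq_mul, mul_inv_cancel_left₀]
  exact_mod_cast Fintype.card_ne_zero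

variable {f : Fin n → MvPolynomial (Fin n) ℂ} {d : Fin n → ℕ}

lemma isHomogeneous_aeval_of_isWeightedHomogeneous (hf : ∀ i, (f i).IsHomogeneous (d i)) {k : ℕ}
    {q : MvPolynomial (Fin n) ℂ} (hq : q.IsWeightedHomogeneous d k) :
    (aeval f q).IsHomogeneous k := by
  induction hq using IsWeightedHomogeneous.induction_on with
  | zero => simpa using isHomogeneous_zero _ _ _
  | add p q hp hq ihp ihq => simpa using ihp.add ihq
  | monomial m r hm =>
    rw [aeval_monomial, Finsupp.prod_fintype _ _ (by simp), algebraMap_eq]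
    refine IsHomogeneous.C_mul ?_ r
    rw [← hm, Finsupp.weight_apply, Finsupp.sum_fintype _ _ (by simp)]
    refine IsHomogeneous.prod _ _ _ fun i _ => ?_
    rw [smul_eq_mul, mul_comm]
    exact (hf i).pow _

lemma homogeneousComponent_aeval (hf : ∀ i, (f i).IsHomogeneous (d i)) (k : ℕ)
    (q : MvPolynomial (Fin n) ℂ) :
    homogeneousComponent k (aeval f q) = aeval f (weightedHomogeneousComponent d k q) := by
  induction q using MvPolynomial.induction_on' with
  | add p q hp hq => simp only [map_add, hp, hq]
  | monomial m r =>
    have hm := isWeightedHomogeneous_monomial d m r (rfl : Finsupp.weight d m = _)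
    rw [weightedHomogeneousComponent_of_mem hm,
      homogeneousComponent_of_mem (isHomogeneous_aeval_of_isWeightedHomogeneous hf hm)]
    split_ifs <;> simp

namespace IsBasicInvariants

lemma degree_ne_zero (h : IsBasicInvariants W f d) (i : Fin n) : d i ≠ 0 := by
  intro hi
  have hfi := h.2.1 i
  rw [hi, ← totalDegree_zero_iff_isHomogeneous, totalDegree_eq_zero_iff_eq_C] at hfi
  have hX : (X i : MvPolynomial (Fin n) ℂ) = C (coeff 0 (f i)) := by
    apply h.2.2.1
    rw [aeval_X, aeval_C, algebraMap_eq]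
    exact hfi
  have := congrArg totalDegree hX
  simp at this

lemma finrank_homogeneousInvariants (h : IsBasicInvariants W f d) (k : ℕ) :
    Module.finrank ℂ (homogeneousInvariants W k) =
      (exponentsOfWeight d h.degree_ne_zero k).card := by
  have hmap : (homogeneousInvariants W k).map (Submodule.subtype _) =
      (weightedHomogeneousSubmodule ℂ d k).map (aeval (R := ℂ) f).toLinearMap := by
    ext p
    constructor
    · rintro ⟨p, hp, rfl⟩
      have hp' : (p : MvPolynomial (Fin n) ℂ) ∈ (aeval (R := ℂ) f).range := by
        rw [h.2.2.2]; exact hp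
      obtain ⟨q, hq⟩ := hp'
      refine ⟨weightedHomogeneousComponent d k q, weightedHomogeneousComponent_mem _ _ _, ?_⟩
      have hq' : aeval f q = (p : MvPolynomial (Fin n) ℂ) := hq
      rw [AlgHom.toLinearMap_apply, ← homogeneousComponent_aeval h.2.1, hq',
        homogeneousComponent_of_mem p.2, if_pos rfl, Submodule.subtype_apply]
    · rintro ⟨q, hq, rfl⟩
      refine ⟨⟨aeval f q, isHomogeneous_aeval_of_isWeightedHomogeneous h.2.1 hq⟩, ?_, rfl⟩
      change aeval f q ∈ invariantsAlg W
      rw [← h.2.2.2]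
      exact ⟨q, rfl⟩
  rw [← Submodule.finrank_map_subtype_eq, hmap,
    ← (Submodule.equivMapOfInjective _ h.2.2.1 _).finrank_eq,
    Module.finrank_eq_card_basis (weightedHomogeneousBasis d h.degree_ne_zero k),
    Fintype.card_coe]

/-- Molien's formula: the Hilbert series of the invariants is the average of the series
`∏ i, (1 - x g i * X)⁻¹`, where `x g` lists the eigenvalues of `g`. -/
lemma molien [Fintype W] (h : IsBasicInvariants W f d) {x : W → Fin n → ℂ}
    (hx : ∀ g : W, HasEigenvalueFamily g.1 (x g)) :
    PowerSeries.C (Fintype.card W : ℂ) * ∏ i, geometricSeries 1 (d i) =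
      ∑ g, ∏ i, geometricSeries (x g i) 1 := by
  ext k
  have hone (g : W) := prod_geometricSeries (1 : Fin n → ℕ) (fun _ => one_ne_zero) (x g)
  simp only [Pi.one_apply] at hone
  rw [PowerSeries.coeff_C_mul, map_sum,
    prod_geometricSeries d h.degree_ne_zero fun _ => 1, PowerSeries.coeff_mk]
  simp only [hone, PowerSeries.coeff_mk, ← (hx _).trace_homogeneousAct]
  rw [← card_mul_finrank_homogeneousInvariants, h.finrank_homogeneousInvariants]
  simp

end IsBasicInvariants

end Molien

section Asymptotics

open Filter Topology

/-- The function `(1 - t) / (1 - a * t)`, extended continuously to `t = 1` when `a = 1`. -/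
noncomputable def reflectionFactor (a t : ℂ) : ℂ :=
  if a = 1 then 1 else (1 - t) * (1 - a * t)⁻¹

lemma reflectionFactor_one (a : ℂ) : reflectionFactor a 1 = if a = 1 then 1 else 0 := by
  simp [reflectionFactor]

lemma reflectionFactor_of_ne {t : ℂ} (ht : t ≠ 1) (a : ℂ) :
    reflectionFactor a t = (1 - t) * (1 - a * t)⁻¹ := by
  unfold reflectionFactor
  split_ifs with h
  · rw [h, one_mul, mul_inv_cancel₀ (sub_ne_zero.mpr ht.symm)]
  · rfl

lemma hasDerivAt_reflectionFactor (a : ℂ) :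
    HasDerivAt (reflectionFactor a) (if a = 1 then 0 else -(1 - a)⁻¹) 1 := by
  by_cases h : a = 1
  · have : reflectionFactor a = fun _ => 1 := by ext t; simp [reflectionFactor, h]
    rw [if_pos h, this]
    exact hasDerivAt_const _ _
  · have : reflectionFactor a = fun t => (1 - t) * (1 - a * t)⁻¹ := by
      ext t; simp [reflectionFactor, h]
    rw [if_neg h, this]
    have ha : 1 - a * 1 ≠ 0 := by rw [mul_one]; exact sub_ne_zero.mpr (Ne.symm h)
    have h1 := (hasDerivAt_id (1 : ℂ)).const_sub 1
    have h2 := (((hasDerivAt_id (1 : ℂ)).const_mul a).const_sub 1).inv ha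
    refine (h1.fun_mul h2).congr_deriv ?_
    simp

/-- The function `(1 - t) / (1 - t ^ d)`, extended continuously to `t = 1`. -/
noncomputable def degreeFactor (d : ℕ) (t : ℂ) : ℂ := (∑ j ∈ Finset.range d, t ^ j)⁻¹

lemma degreeFactor_one (d : ℕ) : degreeFactor d 1 = (d : ℂ)⁻¹ := by
  simp [degreeFactor]

lemma degreeFactor_of_ne {t : ℂ} (ht : t ≠ 1) (d : ℕ) :
    degreeFactor d t = (1 - t) * (1 - t ^ d)⁻¹ := by
  rw [← mul_neg_geom_sum, mul_inv, mul_inv_cancel_left₀ (sub_ne_zero.mpr ht.symm), degreeFactor]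

lemma hasDerivAt_degreeFactor {d : ℕ} (hd : d ≠ 0) :
    HasDerivAt (degreeFactor d) ((d : ℂ)⁻¹ * (-((d - 1 : ℕ) : ℂ) / 2)) 1 := by
  have h : HasDerivAt (fun t : ℂ => ∑ j ∈ Finset.range d, t ^ j)
      (∑ j ∈ Finset.range d, (j : ℂ) * 1 ^ (j - 1)) 1 :=
    HasDerivAt.fun_sum fun j _ => hasDerivAt_pow j 1
  have hd' : (d : ℂ) ≠ 0 := by exact_mod_cast hd
  refine (h.fun_inv (by simpa using hd')).congr_deriv ?_
  have hsum : (∑ j ∈ Finset.range d, (j : ℂ)) * 2 = d * ((d - 1 : ℕ) : ℂ) := by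
    rw [← Nat.cast_sum]
    exact_mod_cast Finset.sum_range_id_mul_two d
  simp only [one_pow, mul_one, Finset.sum_const, Finset.card_range, nsmul_eq_mul]
  field_simp
  linear_combination -hsum

/-- The derivative at `1` of the function `t ↦ ∏ i, (1 - t) / (1 - x i * t)`. -/
noncomputable def reflectionTerm (x : Fin n → ℂ) : ℂ :=
  ∑ i, (∏ j ∈ Finset.univ.erase i, if x j = 1 then (1 : ℂ) else 0) *
    if x i = 1 then 0 else -(1 - x i)⁻¹

lemma hasDerivAt_prod_reflectionFactor (x : Fin n → ℂ) :
    HasDerivAt (fun t => ∏ i, reflectionFactor (x i) t) (reflectionTerm x) 1 := by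
  refine (HasDerivAt.fun_finsetProd fun i (_ : i ∈ Finset.univ) =>
    hasDerivAt_reflectionFactor (x i)).congr_deriv ?_
  simp [reflectionTerm, reflectionFactor_one]

lemma hasDerivAt_prod_degreeFactor {d : Fin n → ℕ} (hd : ∀ i, d i ≠ 0) :
    HasDerivAt (fun t => ∏ i, degreeFactor (d i) t)
      ((∏ i, (d i : ℂ)⁻¹) * (-((∑ i, (d i - 1) : ℕ) : ℂ) / 2)) 1 := by
  refine (HasDerivAt.fun_finsetProd fun i (_ : i ∈ Finset.univ) =>
    hasDerivAt_degreeFactor (hd i)).congr_deriv ?_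
  simp only [degreeFactor_one, smul_eq_mul, ← mul_assoc]
  rw [Finset.sum_congr rfl fun i _ => by
    rw [Finset.prod_erase_mul _ _ (Finset.mem_univ i)], ← Finset.mul_sum, Nat.cast_sum,
    ← Finset.sum_neg_distrib, Finset.sum_div]

lemma reflectionTerm_add_reflectionTerm_inv {x : Fin n → ℂ} (hx : ∀ i, x i ≠ 0)
    [Decidable (∃! i, x i ≠ 1)] :
    reflectionTerm x + reflectionTerm x⁻¹ = -if ∃! i, x i ≠ 1 then 1 else 0 := by
  have hterm (i : Fin n) :
      ((if x i = 1 then 0 else -(1 - x i)⁻¹) + if x i = 1 then 0 else -(1 - (x i)⁻¹)⁻¹ : ℂ) =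
        if x i = 1 then 0 else -1 := by
    split_ifs with h
    · simp
    · have h1 : 1 - x i ≠ 0 := sub_ne_zero.mpr (Ne.symm h)
      have h2 : x i - 1 ≠ 0 := sub_ne_zero.mpr h
      have h3 := hx i
      rw [show 1 - (x i)⁻¹ = (x i - 1) / x i by field_simp]
      field_simp
      ring
  simp only [reflectionTerm, Pi.inv_apply, inv_eq_one, ← Finset.sum_add_distrib, ← mul_add, hterm]
  simp_rw [Finset.prod_ite_zero]
  split_ifs with h
  · obtain ⟨i, hi, huniq⟩ := h
    have hone (j : Fin n) (hj : j ≠ i) : x j = 1 := by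
      by_contra h
      exact hj (huniq j h)
    rw [Finset.sum_eq_single i]
    · rw [if_pos fun j hj => hone j (Finset.ne_of_mem_erase hj), if_neg hi]
      simp
    · intro j _ hj
      rw [if_pos (hone j hj), mul_zero]
    · simp
  · rw [neg_zero]
    refine Finset.sum_eq_zero fun i _ => ?_
    by_cases hi : x i = 1
    · rw [if_pos hi, mul_zero]
    · rw [if_neg, zero_mul]
      refine fun hall => h ⟨i, hi, fun j hj => ?_⟩
      by_contra hji
      exact hj (hall j (Finset.mem_erase.mpr ⟨hji, Finset.mem_univ j⟩))

lemma eventually_eval_ne_zero {ι : Type*} [Finite ι] {P : ι → Polynomial ℂ} (hP : ∀ s, P s ≠ 0)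
    (a : ℂ) : ∀ᶠ t in 𝓝[≠] a, ∀ s, (P s).eval t ≠ 0 := by
  refine eventually_all.mpr fun s => ?_
  have hfin : {t | (P s).IsRoot t}.Finite := Polynomial.finite_setOfPred_isRoot (hP s)
  have hmem : ({t | (P s).IsRoot t} \ {a})ᶜ ∈ 𝓝 a :=
    (hfin.subset Set.sdiff_subset).isClosed.compl_mem_nhds (by simp)
  filter_upwards [mem_nhdsWithin_of_mem_nhds hmem, self_mem_nhdsWithin] with t ht hta hroot
  exact ht ⟨hroot, hta⟩

namespace IsBasicInvariants

variable {W : Subgroup ((Fin n → ℂ) ≃ₗ[ℂ] (Fin n → ℂ))} [Fintype W]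
  {f : Fin n → MvPolynomial (Fin n) ℂ} {d : Fin n → ℕ}

lemma eventually_prod_degreeFactor (h : IsBasicInvariants W f d) {x : W → Fin n → ℂ}
    (hx : ∀ g : W, HasEigenvalueFamily g.1 (x g)) :
    ∀ᶠ t in 𝓝[≠] (1 : ℂ), (Fintype.card W : ℂ) * ∏ i, degreeFactor (d i) t =
      ∑ g, ∏ i, reflectionFactor (x g i) t := by
  let w : Option W → Fin n → ℕ := fun s => s.elim d fun _ _ => 1
  let y : Option W → Fin n → ℂ := fun s => s.elim (fun _ => 1) x
  let c : Option W → ℂ := fun s => s.elim (Fintype.card W : ℂ) fun _ => -1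
  have hw (s : Option W) (i : Fin n) : w s i ≠ 0 := by
    cases s with
    | none => exact h.degree_ne_zero i
    | some g => exact one_ne_zero
  let P : Option W → Polynomial ℂ := fun s =>
    ∏ i, (1 - Polynomial.C (y s i) * Polynomial.X ^ w s i)
  let F : Option W → PowerSeries ℂ := fun s => ∏ i, geometricSeries (y s i) (w s i)
  have hFP (s : Option W) : F s * (P s : PowerSeries ℂ) = 1 := by
    have hcoe : (P s : PowerSeries ℂ) = ∏ i,
        ((1 - Polynomial.C (y s i) * Polynomial.X ^ w s i : Polynomial ℂ) : PowerSeries ℂ) := by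
      simp only [P, ← Polynomial.coeToPowerSeries.ringHom_apply, map_prod]
    rw [hcoe, ← Finset.prod_mul_distrib]
    exact Finset.prod_eq_one fun i _ => geometricSeries_mul_one_sub _ (hw s i)
  have hP (s : Option W) : P s ≠ 0 := by
    intro hs
    have := hFP s
    simp [hs] at this
  have hF : ∑ s, PowerSeries.C (c s) * F s = 0 := by
    rw [Fintype.sum_option]
    simp only [c, F, w, y, Option.elim_none, Option.elim_some, h.molien hx]
    simp
  filter_upwards [eventually_eval_ne_zero hP 1, self_mem_nhdsWithin] with t ht ht1
  have key := sum_mul_eval_inv_eq_zero c F P hFP hF t ht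
  rw [Fintype.sum_option] at key
  simp only [c, P, w, y, Option.elim_none, Option.elim_some, Polynomial.eval_prod,
    Polynomial.eval_sub, Polynomial.eval_one, Polynomial.eval_mul, Polynomial.eval_C,
    Polynomial.eval_pow, Polynomial.eval_X, one_mul, pow_one, ← Finset.prod_inv_distrib, neg_mul,
    Finset.sum_neg_distrib] at key
  simp only [degreeFactor_of_ne ht1, reflectionFactor_of_ne ht1, Finset.prod_mul_distrib,
    ← Finset.mul_sum]
  linear_combination (∏ _i : Fin n, (1 - t)) * key

lemma card_mul_prod_inv_degree (h : IsBasicInvariants W f d) {x : W → Fin n → ℂ}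
    (hx : ∀ g : W, HasEigenvalueFamily g.1 (x g)) :
    (Fintype.card W : ℂ) * ∏ i, (d i : ℂ)⁻¹ = 1 ∧
      (Fintype.card W : ℂ) * ((∏ i, (d i : ℂ)⁻¹) * (-((∑ i, (d i - 1) : ℕ) : ℂ) / 2)) =
        ∑ g, reflectionTerm (x g) := by
  have hev := h.eventually_prod_degreeFactor hx
  have hL := (hasDerivAt_prod_degreeFactor h.degree_ne_zero).const_mul (Fintype.card W : ℂ)
  have hR := HasDerivAt.fun_sum fun g (_ : g ∈ Finset.univ) =>
    hasDerivAt_prod_reflectionFactor (x g)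
  have hval := tendsto_nhds_unique_of_eventuallyEq
    (hL.continuousAt.tendsto.mono_left nhdsWithin_le_nhds)
    (hR.continuousAt.tendsto.mono_left nhdsWithin_le_nhds) hev
  refine ⟨?_, hL.unique (hR.congr_of_eventuallyEq
    (eventuallyEq_nhds_of_eventuallyEq_nhdsNE hev hval))⟩
  simp only [degreeFactor_one, reflectionFactor_one, Finset.prod_ite_zero] at hval
  rw [hval, Finset.sum_eq_single 1]
  · rw [if_pos fun i _ => (hx 1).forall_eq_one_iff.mpr rfl i, Finset.prod_const_one]
  · intro g _ hg
    refine if_neg fun hall => hg (Subtype.ext ?_)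
    exact (hx g).forall_eq_one_iff.mp fun i => hall i (Finset.mem_univ i)
  · simp

lemma sum_reflectionTerm (h : IsBasicInvariants W f d) {x : W → Fin n → ℂ}
    (hx : ∀ g : W, HasEigenvalueFamily g.1 (x g)) :
    ∑ g, reflectionTerm (x g) = -((∑ i, (d i - 1) : ℕ) : ℂ) / 2 := by
  obtain ⟨hval, hderiv⟩ := h.card_mul_prod_inv_degree hx
  rw [← hderiv, ← mul_assoc, hval, one_mul]

end IsBasicInvariants

end Asymptotics

/-- The number of pseudo-reflections in a finite complex reflection group equals
the sum of the exponents `m_i = d_i - 1`. -/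
theorem card_reflections_eq_sum_exponents
    (W : Subgroup ((Fin n → ℂ) ≃ₗ[ℂ] (Fin n → ℂ)))
    [Fintype W] (hW : IsReflectionGroup W)
    (f : Fin n → MvPolynomial (Fin n) ℂ) (d : Fin n → ℕ)
    (hf : IsBasicInvariants W f d) :
    Nat.card {g : (Fin n → ℂ) ≃ₗ[ℂ] (Fin n → ℂ) // g ∈ W ∧ IsPseudoReflection g} =
      ∑ i, (d i - 1) := by
  classical
  have hfin (g : W) : IsOfFinOrder g.1 :=
    (Subgroup.subtype W).isOfFinOrder (isOfFinOrder_of_finite g)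
  choose x hx using fun g : W => exists_hasEigenvalueFamily (hfin g)
  have hinv (g : W) : HasEigenvalueFamily g.1 (x g⁻¹)⁻¹ := by
    simpa using (hx g⁻¹).inv
  have hsum : ∑ g, (reflectionTerm (x g) + reflectionTerm (x g)⁻¹) =
      -((∑ i, (d i - 1) : ℕ) : ℂ) := by
    have hsum_inv := (Equiv.sum_comp (Equiv.inv W) fun g => reflectionTerm (x g)⁻¹).symm.trans <|
      hf.sum_reflectionTerm hinv
    rw [Finset.sum_add_distrib, hf.sum_reflectionTerm hx, hsum_inv]
    ring
  have hterm (g : W) : reflectionTerm (x g) + reflectionTerm (x g)⁻¹ =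
      -if IsPseudoReflection g.1 then 1 else 0 := by
    simp only [reflectionTerm_add_reflectionTerm_inv (hx g).ne_zero,
      (hx g).isPseudoReflection_iff (hfin g)]
  rw [Finset.sum_congr rfl fun g _ => hterm g, Finset.sum_neg_distrib, neg_inj,
    Finset.sum_boole] at hsum
  rw [← Nat.cast_inj (R := ℂ), ← hsum, ← Fintype.card_subtype, ← Nat.card_eq_fintype_card]
  exact congrArg _ (Nat.card_congr (Equiv.subtypeSubtypeEquivSubtypeInter _ _).symm)
end

section
/- Let W ≤ GL(V) be a finite complex reflection group and V' ≤ V a subspace. Then the pointwise stabiliser W_{V'} = {g ∈ W : g·v = v for all v ∈ V'} is generated by the reflections it contains, i.e., by the reflections of W whose fixed hyperplane contains V'. -/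
open MvPolynomial

variable {n : ℕ}

/-- The pointwise stabiliser `W_{V'}` of a subspace `V' ≤ V` in `W`. -/
noncomputable def pointwiseStabiliser (W : Subgroup ((Fin n → ℂ) ≃ₗ[ℂ] (Fin n → ℂ)))
    (V' : Submodule ℂ (Fin n → ℂ)) : Subgroup ((Fin n → ℂ) ≃ₗ[ℂ] (Fin n → ℂ)) where
  carrier := {g | g ∈ W ∧ ∀ v ∈ V', g v = v}
  one_mem' := ⟨W.one_mem, fun _ _ => rfl⟩
  mul_mem' := by
    rintro a b ⟨haW, ha⟩ ⟨hbW, hb⟩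
    refine ⟨W.mul_mem haW hbW, fun v hv => ?_⟩
    have : (a * b) v = a (b v) := rfl
    rw [this, hb v hv, ha v hv]
  inv_mem' := by
    rintro a ⟨haW, ha⟩
    refine ⟨W.inv_mem haW, fun v hv => ?_⟩
    conv_lhs => rw [← ha v hv]
    exact a.symm_apply_apply v

open scoped TensorProduct

section Invariants

variable {B S G : Type*} [CommRing B] [CommRing S] [Algebra B S] [Group G]
  [MulSemiringAction G S] [SMulCommClass G B S]

/-- If every generator of `G` acts trivially on `x` modulo a `G`-stable ideal, so does `G`. -/
theorem smul_sub_mem_of_closure_eq_top {X : Set G} (hX : Subgroup.closure X = ⊤) {J : Ideal S}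
    (hJ : ∀ g : G, ∀ y ∈ J, g • y ∈ J) {x : S} (h : ∀ s ∈ X, s • x - x ∈ J) (g : G) :
    g • x - x ∈ J := by
  have hg : g ∈ Subgroup.closure X := hX ▸ Subgroup.mem_top g
  induction hg using Subgroup.closure_induction with
  | mem s hs => exact h s hs
  | one => simp
  | mul a b _ _ ha hb =>
    have := J.add_mem (hJ a _ hb) ha
    rwa [smul_sub, smul_smul, sub_add_sub_cancel] at this
  | inv a _ ha =>
    have := J.neg_mem (hJ a⁻¹ _ ha)
    rwa [smul_sub, inv_smul_smul, neg_sub] at this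

theorem smul_mem_map_algebraMap (a : Ideal B) (g : G) {y : S}
    (hy : y ∈ a.map (algebraMap B S)) : g • y ∈ a.map (algebraMap B S) := by
  have : a.map (algebraMap B S) ≤
      (a.map (algebraMap B S)).comap (MulSemiringAction.toRingHom G S g) := by
    refine Ideal.map_le_iff_le_comap.2 fun b hb => ?_
    simpa using Ideal.mem_map_of_mem (algebraMap B S) hb
  exact this hy

variable [IsDomain S] [FaithfulSMul B S] [Algebra.IsInvariant B S G] [Finite G]

/-- Chevalley's lemma: if `∑ uᵢ vᵢ = 0` with `uᵢ` invariant, then `v₀` lies in the extension of the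
ideal of those `c` for which `c u₀` is a combination of the remaining `uᵢ`. -/
theorem mem_map_comap_span_of_sum_smul_eq_zero (hG : IsUnit (Nat.card G : S)) {X : Set G}
    (hX : Subgroup.closure X = ⊤) (deg : S → ℕ)
    (h : ∀ s ∈ X, ∃ α : S, α ≠ 0 ∧ ∀ p : S, ∃ q : S, s • p - p = α * q ∧ (q = 0 ∨ deg q < deg p))
    {l : ℕ} (u : Fin (l + 1) → B) (N : ℕ) (v : Fin (l + 1) → S) (hN : deg (v 0) < N)
    (huv : ∑ i, u i • v i = 0) :
    v 0 ∈ Ideal.map (algebraMap B S) (Submodule.comap (LinearMap.mulRight B (u 0))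
      (Ideal.span (Set.range fun i : Fin l => u i.succ))) := by
  have := Fintype.ofFinite G
  induction N generalizing v with
  | zero => omega
  | succ N ih =>
    set a := Submodule.comap (LinearMap.mulRight B (u 0))
      (Ideal.span (Set.range fun i : Fin l => u i.succ)) with ha
    have key : ∀ g : G, g • v 0 - v 0 ∈ Ideal.map (algebraMap B S) a := by
      refine smul_sub_mem_of_closure_eq_top hX (fun g y => smul_mem_map_algebraMap a g) ?_
      intro s hs
      obtain ⟨α, hα, hp⟩ := h s hs
      choose q hq hdeg using hp
      rw [hq]
      refine Ideal.mul_mem_left _ _ ?_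
      rcases hdeg (v 0) with h0 | h0
      · rw [h0]; exact zero_mem _
      · refine ih (fun i => q (v i)) (by omega) ?_
        refine (mul_eq_zero.1 (?_ : α * _ = 0)).resolve_left hα
        simp only [Finset.mul_sum, mul_smul_comm, ← hq, smul_sub, Finset.sum_sub_distrib, huv]
        have := congrArg (s • ·) huv
        simpa [Finset.smul_sum, smul_comm s] using this
    have inv : ∀ i, ∃ t : B, algebraMap B S t = ∑ g : G, g • v i := by
      intro i
      refine Algebra.IsInvariant.isInvariant (G := G) _ fun g => ?_
      simp only [Finset.smul_sum, smul_smul]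
      exact Fintype.sum_equiv (Equiv.mulLeft g) _ _ fun _ => rfl
    choose t ht using inv
    have hut : ∑ i, u i * t i = 0 := by
      apply FaithfulSMul.algebraMap_injective B S
      simp only [map_sum, map_mul, ht, map_zero, ← Algebra.smul_def, Finset.smul_sum]
      rw [Finset.sum_comm]
      refine Finset.sum_eq_zero fun g _ => ?_
      have := congrArg (g • ·) huv
      simpa [Finset.smul_sum, smul_comm g] using this
    have ht0 : t 0 ∈ a := by
      rw [ha, Submodule.mem_comap, LinearMap.mulRight_apply, Ideal.mem_span_range_iff_exists_fun]
      refine ⟨fun i => - t i.succ, ?_⟩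
      rw [Fin.sum_univ_succ] at hut
      simp only [neg_mul, Finset.sum_neg_distrib]
      simp only [mul_comm (t _)]
      linear_combination -hut
    have h1 : ∑ g : G, (g • v 0 - v 0) ∈ Ideal.map (algebraMap B S) a :=
      sum_mem fun g _ => key g
    have h2 := Ideal.mem_map_of_mem (algebraMap B S) ht0
    rw [ht] at h2
    have h3 := sub_mem h2 h1
    rw [Finset.sum_sub_distrib, sub_sub_cancel, Finset.sum_const, Finset.card_univ,
      nsmul_eq_mul, ← Nat.card_eq_fintype_card] at h3
    exact (Ideal.unit_mul_mem_iff_mem _ hG).1 h3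

/-- A ring acted upon by a finite group generated by elements having divided differences is
flat over its ring of invariants. -/
theorem flat_of_dividedDifferences (hG : IsUnit (Nat.card G : S)) {X : Set G}
    (hX : Subgroup.closure X = ⊤) (deg : S → ℕ)
    (h : ∀ s ∈ X, ∃ α : S, α ≠ 0 ∧ ∀ p : S, ∃ q : S,
      s • p - p = α * q ∧ (q = 0 ∨ deg q < deg p)) :
    Module.Flat B S := by
  refine Module.Flat.of_forall_isTrivialRelation fun {l u v} huv => ?_
  induction l with
  | zero => exact ⟨0, fun _ _ => 0, fun _ => 0, fun i => i.elim0, fun i => i.elim0⟩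
  | succ l ih =>
    have hv := mem_map_comap_span_of_sum_smul_eq_zero hG hX deg h u _ v (Nat.lt_succ_self _) huv
    obtain ⟨K, t, c, hc⟩ := Submodule.mem_span_set'.1 hv
    choose c' hc' hcc using fun k => (c k).2
    have hd : ∀ k, ∃ d : Fin l → B, ∑ i, d i * u i.succ = c' k * u 0 := fun k =>
      Ideal.mem_span_range_iff_exists_fun.1 (hc' k)
    choose d hd using hd
    have hv0 : v 0 = ∑ k, c' k • t k := by
      rw [← hc]
      refine Finset.sum_congr rfl fun k _ => ?_
      rw [Algebra.smul_def (c' k), hcc, smul_eq_mul, mul_comm]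
    obtain ⟨m, a, y, hy, hay⟩ := ih (u := fun i => u i.succ)
      (v := fun i => v i.succ + ∑ k, d k i • t k) (by
        rw [Fin.sum_univ_succ] at huv
        simp only [smul_add, Finset.sum_add_distrib, Finset.smul_sum, smul_smul]
        rw [← huv, Finset.sum_comm, add_comm, hv0, Finset.smul_sum]
        congr 1
        refine Finset.sum_congr rfl fun k _ => ?_
        rw [← Finset.sum_smul, smul_smul, mul_comm (u 0), ← hd]
        simp only [mul_comm])
    refine ⟨m + K, Fin.cons (Fin.append 0 c') (fun i => Fin.append (a i) (fun k => - d k i)),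
      Fin.append y t, ?_, ?_⟩
    · intro i
      refine Fin.cases ?_ (fun i => ?_) i
      · simp [Fin.sum_univ_add, hv0]
      · simp [Fin.sum_univ_add, ← hy]
    · intro j
      rw [Fin.sum_univ_succ]
      refine Fin.addCases (fun j => ?_) (fun k => ?_) j
      · simp [hay]
      · simp only [Fin.cons_zero, Fin.cons_succ, Fin.append_right, mul_neg,
          Finset.sum_neg_distrib]
        have := hd k
        simp only [mul_comm _ (u _)] at this
        rw [this, add_neg_cancel]

end Invariants
section Inertia

/-- In a flat module over a domain, a relation between the multiples of two elements by a
non-multiple of a prime and by the prime itself comes from divisibility. -/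
theorem Module.Flat.exists_eq_smul_of_smul_eq_smul {S M : Type*} [CommRing S]
    [AddCommGroup M] [Module S M] [Module.Flat S M] {p s : S} (hp : Prime p) (hs : ¬ p ∣ s)
    {x y : M} (h : s • x = p • y) : ∃ z, x = p • z := by
  obtain ⟨k, a, w, hx, ha⟩ := Module.Flat.isTrivialRelation_of_sum_smul_eq_zero
    (f := ![s, -p]) (x := ![x, y]) (by simp [h])
  have hdvd : ∀ j, p ∣ a 0 j := fun j => by
    have := ha j
    simp only [Fin.sum_univ_two, Matrix.cons_val_zero, Matrix.cons_val_one] at this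
    exact (hp.dvd_or_dvd ⟨a 1 j, by linear_combination this⟩).resolve_left hs
  choose c hc using hdvd
  refine ⟨∑ j, c j • w j, ?_⟩
  have := hx 0
  simpa [hc, Finset.smul_sum, mul_smul] using this

variable {B S G : Type*} [CommRing B] [CommRing S] [Algebra B S] [Group G]
  [MulSemiringAction G S] [SMulCommClass G B S]

variable (B S) in
/-- The algebra map `a ⊗ b ↦ a * (g • b)`. -/
noncomputable def mulTwist (g : G) : S ⊗[B] S →ₐ[S] S :=
  Algebra.TensorProduct.lift (AlgHom.id S S) (MulSemiringAction.toAlgHom B S g)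
    fun _ _ => Commute.all _ _

@[simp]
theorem mulTwist_tmul (g : G) (a b : S) : mulTwist B S g (a ⊗ₜ b) = a * g • b := by
  simp [mulTwist]

theorem mulTwist_algebraMap (g : G) (a : S) :
    mulTwist B S g (algebraMap S (S ⊗[B] S) a) = a := by
  simp

variable [Finite G]

variable (B) in
/-- If every element of `R` can be separated modulo a prime `P` from every element outside `R`,
then a multiple by an element outside `P` of the indicator function of `R` comes from
`S ⊗[B] S`. -/
theorem exists_mulTwist_eq_indicator {P : Ideal S} (hP : P.IsPrime) {R : Set G}
    (hR : ∀ r ∈ R, ∀ u ∉ R, ∃ b : S, r • b - u • b ∉ P) :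
    ∃ s ∉ P, ∃ z : S ⊗[B] S,
      (∀ g ∈ R, mulTwist B S g z = s) ∧ ∀ g ∉ R, mulTwist B S g z = 0 := by
  classical
  have := Fintype.ofFinite G
  have ha : ∀ r : R, ∃ a : S ⊗[B] S,
      mulTwist B S r.1 a ∉ P ∧ ∀ u ∉ R, mulTwist B S u a = 0 := by
    rintro ⟨r, hr⟩
    choose b hb using fun u : {u // u ∉ R} => hR r hr u.1 u.2
    refine ⟨∏ u, (1 ⊗ₜ b u - algebraMap S _ (u.1 • b u)), ?_, fun u hu => ?_⟩
    · rw [map_prod, hP.prod_mem_iff]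
      rintro ⟨u, -, h⟩
      rw [map_sub, mulTwist_algebraMap, mulTwist_tmul, one_mul] at h
      exact hb u h
    · rw [map_prod]
      refine Finset.prod_eq_zero (Finset.mem_univ ⟨u, hu⟩) ?_
      rw [map_sub, mulTwist_algebraMap, mulTwist_tmul, one_mul, sub_self]
  choose a haP ha0 using ha
  refine ⟨∏ r, mulTwist B S r.1 (a r), ?_, algebraMap S _ (∏ r, mulTwist B S r.1 (a r)) -
    ∏ r, (algebraMap S _ (mulTwist B S r.1 (a r)) - a r), fun g hg => ?_, fun g hg => ?_⟩
  · rw [hP.prod_mem_iff]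
    rintro ⟨r, -, h⟩
    exact haP r h
  · rw [map_sub, mulTwist_algebraMap, map_prod, sub_eq_self]
    refine Finset.prod_eq_zero (Finset.mem_univ ⟨g, hg⟩) ?_
    rw [map_sub, mulTwist_algebraMap, sub_self]
  · rw [map_sub, mulTwist_algebraMap, map_prod, sub_eq_zero]
    refine Finset.prod_congr rfl fun r _ => ?_
    rw [map_sub, mulTwist_algebraMap, ha0 r g hg, sub_zero]

variable [IsDomain S] [FaithfulSMul G S] [Algebra.IsInvariant B S G] [Module.Flat B S]

/-- The maps `a ⊗ b ↦ a * (g • b)` are jointly injective. -/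
theorem eq_zero_of_mulTwist_eq_zero {z : S ⊗[B] S} (hz : ∀ g : G, mulTwist B S g z = 0) :
    z = 0 := by
  have := Fintype.ofFinite G
  obtain ⟨D, hD, y, hy1, hy⟩ := exists_mulTwist_eq_indicator B (P := (⊥ : Ideal S))
    Ideal.isPrime_bot (R := {(1 : G)}) (by
      rintro r rfl u hu
      by_contra! h
      exact hu (FaithfulSMul.eq_of_smul_eq_smul (α := S) fun b =>
        (sub_eq_zero.1 (by simpa using h b)).symm))
  obtain ⟨t, rfl⟩ := TensorProduct.exists_finset y
  have key : ∀ x : S ⊗[B] S,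
      D • x = ∑ i ∈ t, i.1 ⊗ₜ[B] ∑ g : G, g • (i.2 * mulTwist B S g⁻¹ x) := by
    intro x
    induction x with
    | zero => simp
    | add x x' hx hx' =>
      simp only [smul_add, hx, hx', map_add, mul_add, Finset.sum_add_distrib,
        TensorProduct.tmul_add]
    | tmul a b =>
      have htr : ∀ i : S × S, ∃ c : B, algebraMap B S c = ∑ g : G, g • (i.2 * a) := by
        intro i
        refine Algebra.IsInvariant.isInvariant (G := G) _ fun g => ?_
        simp only [Finset.smul_sum, smul_smul]
        exact Fintype.sum_equiv (Equiv.mulLeft g) _ _ fun _ => rfl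
      choose c hc using htr
      have h1 : ∀ i : S × S, ∑ g : G, g • (i.2 * mulTwist B S g⁻¹ (a ⊗ₜ b)) = c i • b := by
        intro i
        rw [Algebra.smul_def, hc, Finset.sum_mul]
        refine Finset.sum_congr rfl fun g _ => ?_
        simp [mul_assoc]
      have h2 : ∑ i ∈ t, c i • i.1 = D * a := by
        have : ∀ i : S × S, c i • i.1 = ∑ g : G, (g • a) * mulTwist B S g (i.1 ⊗ₜ i.2) := by
          intro i
          rw [Algebra.smul_def, hc, Finset.sum_mul]
          refine Finset.sum_congr rfl fun g _ => ?_
          simp only [smul_mul', mulTwist_tmul]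
          ring
        simp only [this]
        rw [Finset.sum_comm]
        simp only [← Finset.mul_sum, ← map_sum]
        rw [Finset.sum_eq_single 1 (fun g _ hg => by rw [hy g hg, mul_zero]) (by simp),
          hy1 1 rfl, one_smul, mul_comm]
      simp only [h1, TensorProduct.tmul_smul, TensorProduct.smul_tmul', smul_eq_mul]
      rw [← TensorProduct.sum_tmul, h2]
  have hDz : D • z = 0 := by simp [key, hz]
  have hreg : IsSMulRegular (S ⊗[B] S) D :=
    Module.Flat.isSMulRegular_of_nonZeroDivisors (mem_nonZeroDivisors_of_ne_zero hD)
  exact hreg (by simpa using hDz)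

end Inertia

/-- Purity: a subgroup containing the inertia groups of all principal primes contained in `I`
contains the inertia group of `I`. -/
theorem mem_of_smul_sub_mem (B : Type*) {S G : Type*} [CommRing B] [CommRing S] [Algebra B S]
    [Group G] [MulSemiringAction G S] [SMulCommClass G B S] [Finite G] [IsDomain S]
    [FaithfulSMul G S] [Algebra.IsInvariant B S G] [Module.Flat B S]
    [UniqueFactorizationMonoid S] {I : Ideal S} (hI : I.IsPrime)
    {R : Subgroup G} (hR : ∀ p ∈ I, Prime p → ∀ g : G, (∀ b : S, p ∣ g • b - b) → g ∈ R)
    {g : G} (hg : ∀ b : S, g • b - b ∈ I) : g ∈ R := by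
  by_contra hgR
  have hmem : ∀ (d : S) (z : S ⊗[B] S), (∀ g ∈ R, mulTwist B S g z = d) →
      (∀ g ∉ R, mulTwist B S g z = 0) → d ∈ I := by
    intro d z hz hz0
    have : ∀ x : S ⊗[B] S, mulTwist B S g x - mulTwist B S (1 : G) x ∈ I := by
      intro x
      induction x with
      | zero => simp
      | add x y hx hy =>
        have := I.add_mem hx hy
        rwa [← add_sub_add_comm, ← map_add, ← map_add] at this
      | tmul a b =>
        simpa [mul_sub] using I.mul_mem_left a (hg b)
    have h := this z
    rw [hz0 g hgR, hz 1 R.one_mem, zero_sub] at h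
    exact neg_mem_iff.1 h
  suffices ∀ d : S, d ≠ 0 → ∀ z : S ⊗[B] S, (∀ g ∈ R, mulTwist B S g z = d) →
      (∀ g ∉ R, mulTwist B S g z = 0) → False by
    obtain ⟨d, hd, z, hz, hz0⟩ := exists_mulTwist_eq_indicator B (P := (⊥ : Ideal S))
      Ideal.isPrime_bot (R := (R : Set G)) (by
        intro r hr u hu
        by_contra! h
        have : r = u := FaithfulSMul.eq_of_smul_eq_smul (α := S) fun b =>
          sub_eq_zero.1 (by simpa using h b)
        exact hu (this ▸ hr))
    exact this d hd z hz hz0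
  intro d
  have hwf : WellFounded (DvdNotUnit (α := S)) := wellFounded_dvdNotUnit
  induction d using hwf.induction with
  | _ d ih =>
  intro hd z hz hz0
  obtain ⟨f, hf, hfd⟩ := UniqueFactorizationMonoid.exists_prime_factors d hd
  have hfI : f.prod ∈ I := (I.mem_iff_of_associated hfd).2 (hmem d z hz hz0)
  obtain ⟨p, hpf, hpI⟩ := (Ideal.IsPrime.multiset_prod_mem_iff_exists_mem hI f).1 hfI
  have hp := hf p hpf
  obtain ⟨d', rfl⟩ := (Multiset.dvd_prod hpf).trans hfd.dvd
  obtain ⟨s, hs, y, hy, hy0⟩ := exists_mulTwist_eq_indicator B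
    ((Ideal.span_singleton_prime hp.ne_zero).2 hp) (R := (R : Set G)) (by
      intro r hr u hu
      by_contra! h
      refine hu ?_
      have hur : u * r⁻¹ ∈ R := hR p hpI hp _ fun b => by
        have := h (r⁻¹ • b)
        rw [Ideal.mem_span_singleton, smul_inv_smul, smul_smul] at this
        rwa [← dvd_neg, neg_sub]
      simpa using R.mul_mem hur hr)
  rw [Ideal.mem_span_singleton] at hs
  have hrel : s • z = p • (d' • y) := by
    refine sub_eq_zero.1 (eq_zero_of_mulTwist_eq_zero (G := G) fun g => ?_)
    rw [map_sub, map_smul, map_smul, map_smul]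
    by_cases hgR : g ∈ R
    · rw [hz g hgR, hy g hgR]; simp only [smul_eq_mul]; ring
    · rw [hz0 g hgR, hy0 g hgR]; simp
  obtain ⟨x, rfl⟩ := Module.Flat.exists_eq_smul_of_smul_eq_smul hp hs hrel
  have hd' : d' ≠ 0 := right_ne_zero_of_mul hd
  refine ih d' ⟨hd', p, hp.not_isUnit, mul_comm _ _⟩ hd' x (fun g hgR => ?_) fun g hgR => ?_
  · have := hz g hgR
    rw [map_smul, smul_eq_mul] at this
    exact mul_left_cancel₀ hp.ne_zero this
  · have := hz0 g hgR
    rw [map_smul, smul_eq_mul] at this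
    exact (mul_eq_zero.1 this).resolve_left hp.ne_zero

section LinearAction

/-- The polynomial function defined by a linear form. -/
noncomputable def linearFormPoly (f : Module.Dual ℂ (Fin n → ℂ)) : MvPolynomial (Fin n) ℂ :=
  ∑ j, C (f (Pi.single j 1)) * X j

@[simp]
theorem eval_linearFormPoly (f : Module.Dual ℂ (Fin n → ℂ)) (x : Fin n → ℂ) :
    eval x (linearFormPoly f) = f x := by
  conv_rhs => rw [pi_eq_sum_univ' x]
  simp [linearFormPoly, mul_comm]

theorem linearFormPoly_ne_zero {f : Module.Dual ℂ (Fin n → ℂ)} (hf : f ≠ 0) :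
    linearFormPoly f ≠ 0 := by
  contrapose! hf
  refine LinearMap.ext fun x => ?_
  rw [← eval_linearFormPoly, hf, map_zero, LinearMap.zero_apply]

theorem isHomogeneous_linearFormPoly (f : Module.Dual ℂ (Fin n → ℂ)) :
    (linearFormPoly f).IsHomogeneous 1 :=
  IsHomogeneous.sum _ _ _ fun _ _ => isHomogeneous_C_mul_X _ _

theorem totalDegree_linearFormPoly {f : Module.Dual ℂ (Fin n → ℂ)} (hf : f ≠ 0) :
    (linearFormPoly f).totalDegree = 1 :=
  (isHomogeneous_linearFormPoly f).totalDegree (linearFormPoly_ne_zero hf)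

/-- The action `(g • p)(x) = p (g⁻¹ x)` of linear automorphisms on polynomial functions, as an
algebra homomorphism. -/
noncomputable def linearAct (g : (Fin n → ℂ) ≃ₗ[ℂ] (Fin n → ℂ)) :
    MvPolynomial (Fin n) ℂ →ₐ[ℂ] MvPolynomial (Fin n) ℂ :=
  aeval fun i => linearFormPoly (LinearMap.proj i ∘ₗ (g⁻¹).toLinearMap)

theorem eval_linearAct (g : (Fin n → ℂ) ≃ₗ[ℂ] (Fin n → ℂ)) (p : MvPolynomial (Fin n) ℂ)
    (x : Fin n → ℂ) : eval x (linearAct g p) = eval (g⁻¹ x) p := by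
  induction p using MvPolynomial.induction_on with
  | C a => simp [linearAct]
  | add p q hp hq => simp [hp, hq]
  | mul_X p i hp =>
    rw [map_mul, map_mul, hp, map_mul, linearAct, aeval_X, eval_linearFormPoly, eval_X]
    rfl

noncomputable instance linearMulSemiringAction :
    MulSemiringAction ((Fin n → ℂ) ≃ₗ[ℂ] (Fin n → ℂ)) (MvPolynomial (Fin n) ℂ) where
  smul g p := linearAct g p
  one_smul p := MvPolynomial.funext fun x => eval_linearAct 1 p x
  mul_smul g h p := MvPolynomial.funext fun x => by
    change eval x (linearAct _ _) = eval x (linearAct _ (linearAct _ _))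
    simp only [eval_linearAct, mul_inv_rev]
    rfl
  smul_zero g := map_zero (linearAct g)
  smul_add g := map_add (linearAct g)
  smul_one g := map_one (linearAct g)
  smul_mul g := map_mul (linearAct g)

theorem eval_smul_linear (g : (Fin n → ℂ) ≃ₗ[ℂ] (Fin n → ℂ)) (p : MvPolynomial (Fin n) ℂ)
    (x : Fin n → ℂ) : eval x (g • p) = eval (g⁻¹ x) p :=
  eval_linearAct g p x

theorem totalDegree_smul_le (g : (Fin n → ℂ) ≃ₗ[ℂ] (Fin n → ℂ)) (p : MvPolynomial (Fin n) ℂ) :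
    (g • p).totalDegree ≤ p.totalDegree := by
  change (linearAct g p).totalDegree ≤ _
  rw [linearAct, aeval_def, eval₂_eq]
  refine totalDegree_finsetSum_le fun d hd => ?_
  refine (totalDegree_mul _ _).trans ?_
  rw [show (algebraMap ℂ (MvPolynomial (Fin n) ℂ)) = C from rfl, totalDegree_C, zero_add]
  refine ((IsHomogeneous.prod _ _ _ fun i _ =>
    (isHomogeneous_linearFormPoly _).pow (d i)).totalDegree_le).trans ?_
  simp only [one_mul]
  exact le_totalDegree hd

theorem eq_of_forall_smul_eq {g h : (Fin n → ℂ) ≃ₗ[ℂ] (Fin n → ℂ)}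
    (H : ∀ p : MvPolynomial (Fin n) ℂ, g • p = h • p) : g = h := by
  rw [← inv_inj]
  ext1 x
  funext i
  simpa [eval_smul_linear] using congrArg (eval x) (H (X i))

instance : FaithfulSMul ((Fin n → ℂ) ≃ₗ[ℂ] (Fin n → ℂ)) (MvPolynomial (Fin n) ℂ) :=
  ⟨eq_of_forall_smul_eq⟩

/-- A linear automorphism fixing a hyperplane pointwise differs from the identity by a map of
rank at most one. -/
theorem exists_dual_of_fixes_hyperplane {g : (Fin n → ℂ) ≃ₗ[ℂ] (Fin n → ℂ)}
    {H : Submodule ℂ (Fin n → ℂ)} (hH : Module.finrank ℂ H + 1 = n) (hg : ∀ v ∈ H, g v = v) :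
    ∃ f : Module.Dual ℂ (Fin n → ℂ), f ≠ 0 ∧ ∃ w : Fin n → ℂ, ∀ x, g x = x + f x • w := by
  have hlt : H < ⊤ := lt_top_iff_ne_top.2 fun h => by
    rw [h, finrank_top, Module.finrank_fin_fun] at hH
    omega
  obtain ⟨f, hf, hHf⟩ := Submodule.exists_le_ker_of_lt_top H hlt
  have hker : H = LinearMap.ker f := by
    refine Submodule.eq_of_le_of_finrank_eq hHf ?_
    have := Module.Dual.finrank_ker_add_one_of_ne_zero hf
    rw [Module.finrank_fin_fun] at this
    omega
  obtain ⟨x₀, hx₀⟩ : ∃ x, f x ≠ 0 := by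
    by_contra! h
    exact hf (LinearMap.ext h)
  refine ⟨f, hf, (f x₀)⁻¹ • (g x₀ - x₀), fun x => ?_⟩
  have h := hg (x - (f x * (f x₀)⁻¹) • x₀) (by simp [hker, hx₀])
  rw [map_sub, map_smul, sub_eq_sub_iff_add_eq_add] at h
  rw [smul_smul, smul_sub, ← add_sub_assoc, ← h, add_sub_cancel_right]

/-- Divided differences along a reflection. -/
theorem exists_dividedDifference {g : (Fin n → ℂ) ≃ₗ[ℂ] (Fin n → ℂ)}
    (hg : IsPseudoReflection g) :
    ∃ α : MvPolynomial (Fin n) ℂ, α ≠ 0 ∧ ∀ p : MvPolynomial (Fin n) ℂ,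
      ∃ q, g • p - p = α * q ∧ (q = 0 ∨ q.totalDegree < p.totalDegree) := by
  obtain ⟨-, -, H, hH, hgH⟩ := hg
  have hgH' : ∀ v ∈ H, g⁻¹ v = v := fun v hv => by
    conv_lhs => rw [← hgH v hv]
    exact g.symm_apply_apply v
  obtain ⟨f, hf, w, hw⟩ := exists_dual_of_fixes_hyperplane hH hgH'
  refine ⟨linearFormPoly f, linearFormPoly_ne_zero hf, fun p => ?_⟩
  have hdvd : linearFormPoly f ∣ g • p - p := by
    rw [← Ideal.mem_span_singleton, ← Ideal.Quotient.eq]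
    let π := Ideal.Quotient.mkₐ ℂ (Ideal.span {linearFormPoly f})
    have : π.comp (linearAct g) = π := by
      refine MvPolynomial.algHom_ext fun i => ?_
      refine Ideal.Quotient.eq.2 (Ideal.mem_span_singleton.2 ⟨C (w i), ?_⟩)
      refine MvPolynomial.funext fun x => ?_
      simp [eval_linearAct, hw]
    exact DFunLike.congr_fun this p
  obtain ⟨q, hq⟩ := hdvd
  refine ⟨q, hq, or_iff_not_imp_left.2 fun hq0 => ?_⟩
  have h1 := totalDegree_mul_of_isDomain (linearFormPoly_ne_zero hf) hq0
  rw [← hq, totalDegree_linearFormPoly hf] at h1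
  have h2 := (totalDegree_sub (g • p) p).trans (max_le (totalDegree_smul_le g p) le_rfl)
  omega

/-- A nontrivial linear automorphism acting trivially on polynomials modulo a prime `p` fixes a
hyperplane pointwise, on which `p` is supported. -/
theorem exists_fixed_hyperplane_of_prime_dvd {g : (Fin n → ℂ) ≃ₗ[ℂ] (Fin n → ℂ)} (hg1 : g ≠ 1)
    {p : MvPolynomial (Fin n) ℂ} (hp : Prime p) (hg : ∀ b, p ∣ g • b - b) :
    ∃ H : Submodule ℂ (Fin n → ℂ), Module.finrank ℂ H + 1 = n ∧ (∀ v ∈ H, g v = v) ∧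
      ∀ v, eval v p = 0 → v ∈ H := by
  let F : Fin n → Module.Dual ℂ (Fin n → ℂ) :=
    fun i => LinearMap.proj i ∘ₗ ((g⁻¹).toLinearMap - LinearMap.id)
  have hF : ∀ i, p ∣ linearFormPoly (F i) := by
    intro i
    convert hg (X i) using 1
    refine MvPolynomial.funext fun x => ?_
    simp [F, eval_smul_linear]
  obtain ⟨i, hi⟩ : ∃ i, F i ≠ 0 := by
    by_contra! h
    refine hg1 (inv_eq_one.1 ?_)
    ext1 x
    funext i
    simpa [F, sub_eq_zero] using LinearMap.congr_fun (h i) x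
  obtain ⟨q, hq⟩ := hF i
  have hfq := linearFormPoly_ne_zero hi
  have hq0 : q ≠ 0 := by rintro rfl; simp [hq] at hfq
  have hdeg := totalDegree_mul_of_isDomain hp.ne_zero hq0
  rw [← hq, totalDegree_linearFormPoly hi] at hdeg
  have hpdeg : p.totalDegree ≠ 0 := fun h => by
    rw [totalDegree_eq_zero_iff_eq_C] at h
    refine hp.not_isUnit ?_
    rw [h]
    refine IsUnit.map C (Ne.isUnit fun h0 => hp.ne_zero ?_)
    rw [h, h0, C_0]
  obtain ⟨c, rfl⟩ : ∃ c, q = C c := ⟨_, totalDegree_eq_zero_iff_eq_C.1 (by omega)⟩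
  have hc : c ≠ 0 := by rintro rfl; simp at hq0
  have heval : ∀ v, F i v = eval v p * c := fun v => by
    rw [← eval_linearFormPoly, hq, map_mul, eval_C]
  refine ⟨LinearMap.ker (F i), ?_, fun v hv => ?_, fun v hv => ?_⟩
  · rw [Module.Dual.finrank_ker_add_one_of_ne_zero hi, Module.finrank_fin_fun]
  · have hpv : eval v p = 0 := by
      have := heval v
      rw [LinearMap.mem_ker.1 hv, eq_comm] at this
      exact (mul_eq_zero.1 this).resolve_right hc
    have : g⁻¹ v = v := by
      funext j
      obtain ⟨r, hr⟩ := hF j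
      have := congrArg (eval v) hr
      rw [map_mul, hpv, zero_mul, eval_linearFormPoly] at this
      simpa [F, sub_eq_zero] using this
    conv_lhs => rw [← this]
    exact g.apply_symm_apply v
  · rw [LinearMap.mem_ker, heval, hv, zero_mul]

/-- A subspace contains a point whose stabiliser in a given finite group is the pointwise
stabiliser of the subspace. -/
theorem exists_stabiliser_eq_pointwiseStabiliser
    (W : Subgroup ((Fin n → ℂ) ≃ₗ[ℂ] (Fin n → ℂ))) [Finite W]
    (V' : Submodule ℂ (Fin n → ℂ)) :
    ∃ v ∈ V', ∀ g ∈ W, g v = v → g ∈ pointwiseStabiliser W V' := by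
  by_contra! h
  let T := {g : W // g.1 ∉ pointwiseStabiliser W V'}
  let K : T → Submodule ℂ V' := fun g =>
    LinearMap.ker ((g.1.1.toLinearMap - LinearMap.id) ∘ₗ V'.subtype)
  have hcov : ⋃ i, (K i : Set V') = Set.univ := by
    refine Set.eq_univ_of_forall fun v => ?_
    obtain ⟨g, hgW, hgv, hg⟩ := h v.1 v.2
    exact Set.mem_iUnion.2 ⟨⟨⟨g, hgW⟩, hg⟩, by simp [K, hgv]⟩
  obtain ⟨g, hg⟩ := Subspace.exists_eq_top_of_iUnion_eq_univ hcov
  refine g.2 ⟨g.1.2, fun v hv => ?_⟩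
  have : (⟨v, hv⟩ : V') ∈ K g := hg ▸ Submodule.mem_top
  simpa [K, sub_eq_zero] using this

end LinearAction

/-- **Steinberg's theorem.** The pointwise stabiliser of any subspace `V'` in a
finite complex reflection group `W` is generated by the reflections of `W` whose
reflecting hyperplane contains `V'`, i.e. which fix `V'` pointwise. -/
theorem steinberg_fixed_point (W : Subgroup ((Fin n → ℂ) ≃ₗ[ℂ] (Fin n → ℂ)))
    [Finite W] (hW : IsReflectionGroup W) (V' : Submodule ℂ (Fin n → ℂ)) :
    Subgroup.closure
        {g | g ∈ W ∧ IsPseudoReflection g ∧ ∀ v ∈ V', g v = v} =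
      pointwiseStabiliser W V' := by
  refine le_antisymm ((Subgroup.closure_le _).2 fun g hg => ⟨hg.1, hg.2.2⟩) ?_
  rintro g ⟨hgW, hgV⟩
  set R := Subgroup.closure {g | g ∈ W ∧ IsPseudoReflection g ∧ ∀ v ∈ V', g v = v}
  obtain ⟨v, hvV, hv⟩ := exists_stabiliser_eq_pointwiseStabiliser W V'
  have hinv : Algebra.IsInvariant (FixedPoints.subring (MvPolynomial (Fin n) ℂ) W)
      (MvPolynomial (Fin n) ℂ) W := ⟨fun b hb => ⟨⟨b, hb⟩, rfl⟩⟩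
  have hgen : Subgroup.closure {s : W | IsPseudoReflection s.1} = ⊤ := by
    refine Subgroup.map_injective W.subtype_injective ?_
    rw [MonoidHom.map_closure, ← MonoidHom.range_eq_map, Subgroup.range_subtype]
    conv_rhs => rw [← hW]
    congr 1
    ext s
    simp [and_comm]
  have hunit : IsUnit (Nat.card W : MvPolynomial (Fin n) ℂ) := by
    rw [← map_natCast (C : ℂ →+* MvPolynomial (Fin n) ℂ)]
    exact IsUnit.map C (Ne.isUnit (Nat.cast_ne_zero.2 Nat.card_pos.ne'))
  have hflat : Module.Flat (FixedPoints.subring (MvPolynomial (Fin n) ℂ) W)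
      (MvPolynomial (Fin n) ℂ) :=
    flat_of_dividedDifferences hunit hgen totalDegree fun s hs => exists_dividedDifference hs
  have hmem := mem_of_smul_sub_mem (FixedPoints.subring (MvPolynomial (Fin n) ℂ) W)
    (RingHom.ker_isPrime (eval v : MvPolynomial (Fin n) ℂ →+* ℂ)) (R := R.subgroupOf W)
    (fun p hpv hp s hs => ?_) (g := ⟨g, hgW⟩) fun b => ?_
  · exact hmem
  · by_cases hs1 : s = 1
    · exact hs1 ▸ one_mem _
    have hs1' : s.1 ≠ 1 := fun h => hs1 (Subtype.ext h)
    obtain ⟨H, hH, hsH, hpH⟩ := exists_fixed_hyperplane_of_prime_dvd hs1' hp hs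
    have hsV := hv s.1 s.2 (hsH v (hpH v hpv))
    exact Subgroup.subset_closure ⟨s.2,
      ⟨hs1', W.subtype.isOfFinOrder (isOfFinOrder_of_finite s), H, hH, hsH⟩, hsV.2⟩
  · have hgv : g⁻¹ v = v := by
      conv_lhs => rw [← hgV v hvV]
      exact g.symm_apply_apply v
    have : eval v (g • b - b) = 0 := by rw [map_sub, eval_smul_linear, hgv, sub_self]
    exact this
end
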